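/- arXiv:1310.3409 — 2 statements merged into one kernel-verified Lean document; each statement's English description precedes it below -/
import Mathlib

section
/- Let P be a discrete polymatroid of rank d on ground set [n] with ground set rank function ρ, and let I be the associated polymatroidal ideal. For a subset F ⊂ [n] let p_F be the monomial prime ideal generated by the variables x_i with i ∈ F. Then the monomial localization I(p_F) is generated in the single degree d − ρ([n] \ F). -/
open MvPolynomial

noncomputable section

variable (K : Type) [Field K]

/-- The monomial prime ideal `p_F` generated by the variables `x_i`, `i ∈ F`. -/
def monomialPrimeIdeal {n : ℕ} (F : Finset (Fin n)) : Ideal (MvPolynomial (Fin n) K) :=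
  Ideal.span ((fun i => (X i : MvPolynomial (Fin n) K)) '' F)

/-- A monomial ideal: an ideal generated by monomials. -/
def IsMonomialIdeal {σ : Type*} (I : Ideal (MvPolynomial σ K)) : Prop :=
  ∃ A : Set (σ →₀ ℕ), I = Ideal.span ((fun u => (monomial u (1 : K))) '' A)

/-- The graded maximal ideal of a polynomial ring. -/
def maxIdeal (σ : Type*) : Ideal (MvPolynomial σ K) :=
  Ideal.span (Set.range (X : σ → MvPolynomial σ K))

/-- The monomial localization map `S → S(p_F)`, sending `x_i ↦ x_i` for `i ∈ F`
and `x_i ↦ 1` otherwise. -/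
def monomialLocalizationMap {n : ℕ} (F : Finset (Fin n)) :
    MvPolynomial (Fin n) K →+* MvPolynomial {i : Fin n // i ∈ F} K :=
  (aeval (fun i : Fin n =>
    if h : i ∈ F then (X ⟨i, h⟩ : MvPolynomial {i : Fin n // i ∈ F} K) else 1)).toRingHom

/-- The monomial localization `I(p_F) ⊆ S(p_F)` of a monomial ideal `I`. -/
def mLoc {n : ℕ} (I : Ideal (MvPolynomial (Fin n) K)) (F : Finset (Fin n)) :
    Ideal (MvPolynomial {i : Fin n // i ∈ F} K) :=
  I.map (monomialLocalizationMap K F)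

/-- `min(J)`: the minimal degree of a nonzero homogeneous element of `J`, which for a
graded ideal is the minimal degree of a generator. -/
def minGenDeg {σ : Type*} (J : Ideal (MvPolynomial σ K)) : ℕ :=
  sInf {d : ℕ | ∃ f ∈ J, f ≠ 0 ∧ MvPolynomial.IsHomogeneous f d}

/-- `max(Soc(S/J))`: the maximal degree of a nonzero homogeneous element of the
socle `(J : m)/J` of `S/J`. -/
def maxSocleDeg {σ : Type*} (J : Ideal (MvPolynomial σ K)) : ℕ :=
  sSup {d : ℕ | ∃ f : MvPolynomial σ K, f ∉ J ∧ MvPolynomial.IsHomogeneous f d ∧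
    ∀ i : σ, X i * f ∈ J}

/-- `I` is of intersection type: `I` is an intersection of (positive) powers of
monomial prime ideals. -/
def IsIntersectionType {n : ℕ} (I : Ideal (MvPolynomial (Fin n) K)) : Prop :=
  ∃ (r : ℕ) (F : Fin r → Finset (Fin n)) (d : Fin r → ℕ),
    (∀ i, 0 < d i) ∧ I = ⨅ i, (monomialPrimeIdeal K (F i)) ^ (d i)

/-- A finite graded free resolution of an ideal `I ⊆ S = K[x_i : i ∈ σ]`:
`⋯ → F_1 → F_0 → I → 0`, where `F_i` is a finite graded free module with basis `ι i`
whose basis element `b` sits in degree `deg i b`, the maps are graded of degree `0`,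
and the complex is exact with the augmentation `F_0 → S` having image `I`. -/
structure GradedFreeResolution (σ : Type) [Fintype σ] (I : Ideal (MvPolynomial σ K)) where
  ι : ℕ → Type
  finite : ∀ i, Finite (ι i)
  deg : ∀ i, ι i → ℕ
  aug : (ι 0 →₀ MvPolynomial σ K) →ₗ[MvPolynomial σ K] MvPolynomial σ K
  d : ∀ i, (ι (i + 1) →₀ MvPolynomial σ K) →ₗ[MvPolynomial σ K] (ι i →₀ MvPolynomial σ K)
  aug_range : ∀ f : MvPolynomial σ K, f ∈ LinearMap.range aug ↔ f ∈ I
  exact_zero : LinearMap.range (d 0) = LinearMap.ker aug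
  exact : ∀ i, LinearMap.range (d (i + 1)) = LinearMap.ker (d i)
  aug_homog : ∀ b : ι 0, MvPolynomial.IsHomogeneous (aug (Finsupp.single b 1)) (deg 0 b)
  d_homog : ∀ (i : ℕ) (b : ι (i + 1)) (a : ι i),
    (d i (Finsupp.single b 1)) a = 0 ∨
      ∃ m, deg (i + 1) b = deg i a + m ∧
        MvPolynomial.IsHomogeneous ((d i (Finsupp.single b 1)) a) m

/-- The Castelnuovo–Mumford regularity of an ideal `I` of a polynomial ring: the least
`r` such that `I` admits a (finite) graded free resolution whose `i`-th free module is
generated in degrees `≤ r + i`; for a finitely generated graded ideal this is the value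
computed from the minimal graded free resolution. -/
def reg {σ : Type} [Fintype σ] (I : Ideal (MvPolynomial σ K)) : ℕ :=
  sInf {r : ℕ | ∃ R : GradedFreeResolution K σ I, ∀ (i : ℕ) (b : R.ι i), R.deg i b ≤ r + i}

/-- `I` is generated in the single degree `t`. -/
def GeneratedInSingleDegree {σ : Type} (I : Ideal (MvPolynomial σ K)) (t : ℕ) : Prop :=
  ∃ A : Set (MvPolynomial σ K), (∀ f ∈ A, MvPolynomial.IsHomogeneous f t) ∧ I = Ideal.span A

/-- `I` has a linear resolution: it is generated in a single degree `t` and its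
Castelnuovo–Mumford regularity equals `t`. -/
def HasLinearResolution {σ : Type} [Fintype σ] (I : Ideal (MvPolynomial σ K)) : Prop :=
  ∃ t : ℕ, GeneratedInSingleDegree K I t ∧ reg K I = t

/-- A discrete polymatroid on the ground set `[n]`: a nonempty finite set of integer
vectors in `ℤ_{≥0}^n` closed under componentwise minimization and satisfying the
exchange property. -/
structure DiscretePolymatroid (n : ℕ) where
  carrier : Finset (Fin n →₀ ℕ)
  nonempty : carrier.Nonempty
  lower : ∀ u ∈ carrier, ∀ v : Fin n →₀ ℕ, v ≤ u → v ∈ carrier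
  exchange : ∀ u ∈ carrier, ∀ v ∈ carrier, (∑ i, u i) < (∑ i, v i) →
    ∃ i : Fin n, u i < v i ∧ u + Finsupp.single i 1 ∈ carrier

namespace DiscretePolymatroid

variable {n : ℕ} (P : DiscretePolymatroid n)

/-- The rank of `P`: the maximal modulus `|u| = ∑ i, u i` of an element of `P`. -/
def rank : ℕ := P.carrier.sup fun u => ∑ i, u i

/-- The set of bases of `P`: the elements of maximal modulus. -/
def bases : Finset (Fin n →₀ ℕ) := P.carrier.filter fun u => (∑ i, u i) = P.rank

/-- The polymatroidal ideal associated with `P`: the ideal generated by the monomials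
`x^u`, `u` a basis of `P`. -/
def toIdeal (K : Type) [Field K] : Ideal (MvPolynomial (Fin n) K) :=
  Ideal.span ((fun u => (monomial u (1 : K))) '' (P.bases : Set (Fin n →₀ ℕ)))

/-- The ground set rank function `ρ` of `P`: `ρ(F) = max {u(F) : u ∈ B(P)}`. -/
def rkFun (F : Finset (Fin n)) : ℕ := P.bases.sup fun u => ∑ i ∈ F, u i

/-- The complementary rank function `τ(F) = d - ρ([n] \ F)`. -/
def crkFun (F : Finset (Fin n)) : ℕ := P.rank - P.rkFun Fᶜ

end DiscretePolymatroid

namespace DiscretePolymatroid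

variable {n : ℕ} (P : DiscretePolymatroid n)

lemma exists_extension {a u : Fin n →₀ ℕ} (ha : a ∈ P.carrier) (hu : u ∈ P.carrier)
    (h : ∑ i, a i ≤ ∑ i, u i) :
    ∃ v ∈ P.carrier, a ≤ v ∧ v ≤ a ⊔ u ∧ ∑ i, v i = ∑ i, u i := by
  obtain ⟨k, hk⟩ := Nat.exists_eq_add_of_le h
  clear h
  induction k generalizing a with
  | zero => exact ⟨a, ha, le_rfl, le_sup_left, by simpa using hk.symm⟩
  | succ k ih =>
    obtain ⟨i, hi, hmem⟩ := P.exchange a ha u hu (by omega)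
    obtain ⟨v, hv, hav, hvu, hsum⟩ := ih hmem (by
      simp [Finset.sum_add_distrib, Finsupp.single_apply]
      omega)
    refine ⟨v, hv, le_trans (by simp) hav, hvu.trans (sup_le (fun j => ?_) le_sup_right), hsum⟩
    simp only [Finsupp.add_apply, Finsupp.sup_apply, Finsupp.single_apply]
    split_ifs with hij
    · subst hij
      exact le_sup_of_le_right hi
    · simp

lemma bases_nonempty : P.bases.Nonempty := by
  obtain ⟨u, hu, h⟩ := Finset.exists_mem_eq_sup P.carrier P.nonempty fun u => ∑ i, u i
  exact ⟨u, Finset.mem_filter.mpr ⟨hu, h.symm⟩⟩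

lemma sum_le_rkFun {u : Fin n →₀ ℕ} (hu : u ∈ P.bases) (F : Finset (Fin n)) :
    ∑ i ∈ F, u i ≤ P.rkFun F :=
  Finset.le_sup (f := fun u : Fin n →₀ ℕ => ∑ i ∈ F, u i) hu

lemma exists_basis_le_of_sum_compl_eq_rkFun {u : Fin n →₀ ℕ} (hu : u ∈ P.bases)
    (F : Finset (Fin n)) :
    ∃ v ∈ P.bases, ∑ i ∈ Fᶜ, v i = P.rkFun Fᶜ ∧ ∀ i ∈ F, v i ≤ u i := by
  obtain ⟨w, hw, hwF⟩ :=
    Finset.exists_mem_eq_sup P.bases P.bases_nonempty fun u => ∑ i ∈ Fᶜ, u i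
  obtain ⟨hwP, hwd⟩ := Finset.mem_filter.mp hw
  obtain ⟨huP, hud⟩ := Finset.mem_filter.mp hu
  have hle : w.filter (· ∉ F) ≤ w := fun i => by
    rw [Finsupp.filter_apply]
    split_ifs <;> simp
  obtain ⟨v, hv, hwv, hvu, hsum⟩ := P.exists_extension (P.lower w hwP _ hle) huP
    ((Finset.sum_le_sum fun i _ => hle i).trans (hwd.trans hud.symm).le)
  have hvb : v ∈ P.bases := Finset.mem_filter.mpr ⟨hv, hsum.trans hud⟩
  refine ⟨v, hvb, (P.sum_le_rkFun hvb _).antisymm ?_, fun i hi => ?_⟩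
  · refine hwF.le.trans (Finset.sum_le_sum fun i hi => ?_)
    have := hwv i
    rwa [Finsupp.filter_apply_pos (· ∉ F) _ (Finset.mem_compl.mp hi)] at this
  · simpa [Finsupp.filter_apply, hi] using hvu i

end DiscretePolymatroid

lemma monomialLocalizationMap_monomial {n : ℕ} (F : Finset (Fin n)) (u : Fin n →₀ ℕ) :
    monomialLocalizationMap K F (monomial u 1) = monomial (u.subtypeDomain (· ∈ F)) 1 := by
  have h : monomialLocalizationMap K F (monomial u 1) = ∏ i : Fin n,
      (if h : i ∈ F then (X ⟨i, h⟩ : MvPolynomial {i : Fin n // i ∈ F} K) else 1) ^ u i := by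
    rw [monomialLocalizationMap, AlgHom.toRingHom_eq_coe, RingHom.coe_coe, aeval_monomial,
      map_one, one_mul, Finsupp.prod_fintype _ _ (by simp)]
  rw [h, monomial_eq, Finsupp.prod_fintype _ _ (by simp), map_one, one_mul,
    ← Finset.prod_subset (Finset.subset_univ F) (fun i _ hi => by simp [hi]),
    ← Finset.prod_coe_sort F]
  simp

/-- Let `P` be a discrete polymatroid of rank `d` with ground set rank
function `ρ` and `I` the associated polymatroidal ideal. Then for `F ⊆ [n]` the
monomial localization `I(p_F)` is generated in the single degree `d - ρ([n] \ F)`. -/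
theorem polymatroidal_localization_generated_in_single_degree {n : ℕ}
    (P : DiscretePolymatroid n) (I : Ideal (MvPolynomial (Fin n) K))
    (hI : I = P.toIdeal K) (F : Finset (Fin n)) :
    GeneratedInSingleDegree K (mLoc K I F) (P.rank - P.rkFun Fᶜ) := by
  subst hI
  refine ⟨(fun u : Fin n →₀ ℕ => monomial (u.subtypeDomain (· ∈ F)) (1 : K)) ''
    {u | u ∈ P.bases ∧ ∑ i ∈ Fᶜ, u i = P.rkFun Fᶜ}, ?_, ?_⟩
  · rintro _ ⟨u, ⟨hu, hF⟩, rfl⟩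
    refine isHomogeneous_monomial _ ?_
    have hd : ∑ i, u i = P.rank := (Finset.mem_filter.mp hu).2
    rw [← hF, ← hd, ← Finset.sum_add_sum_compl F, Nat.add_sub_cancel, Finsupp.degree_eq_sum,
      ← Finset.sum_coe_sort F]
    simp
  · rw [mLoc, DiscretePolymatroid.toIdeal, Ideal.map_span, Set.image_image]
    simp only [monomialLocalizationMap_monomial]
    refine le_antisymm (Ideal.span_le.mpr ?_) (Ideal.span_mono (Set.image_mono fun u hu => hu.1))
    rintro _ ⟨u, hu, rfl⟩
    obtain ⟨v, hv, hvF, hvu⟩ := P.exists_basis_le_of_sum_compl_eq_rkFun hu F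
    refine Ideal.mem_of_dvd _ ?_ (Ideal.subset_span ⟨v, ⟨hv, hvF⟩, rfl⟩)
    exact monomial_dvd_monomial.mpr ⟨Or.inr fun i => hvu i i.2, dvd_rfl⟩

end
end

section
/- Let P be a discrete polymatroid of rank d on ground set [n] with rank function ρ, complementary rank function τ(F) = d − ρ([n]\F), and let I be the associated polymatroidal ideal. Then I = ∩_F p_F^{τ(F)}, where the intersection is taken over all subsets F ⊂ [n] that are τ-closed and τ-inseparable. -/
open MvPolynomial

noncomputable section

variable (K : Type) [Field K]

/-- `F` is `τ`-closed for the complementary rank function `τ` of `P`: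
`τ(G) < τ(F)` for every proper subset `G ⊂ F`. -/
def TauClosed {n : ℕ} (P : DiscretePolymatroid n) (F : Finset (Fin n)) : Prop :=
  ∀ G : Finset (Fin n), G ⊂ F → P.crkFun G < P.crkFun F

/-- `F` is `τ`-inseparable: there are no nonempty disjoint `G, H` with `G ∪ H = F` and
`τ(G) + τ(H) = τ(F)`. -/
def TauInseparable {n : ℕ} (P : DiscretePolymatroid n) (F : Finset (Fin n)) : Prop :=
  ¬ ∃ G H : Finset (Fin n), G.Nonempty ∧ H.Nonempty ∧ Disjoint G H ∧ G ∪ H = F ∧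
    P.crkFun G + P.crkFun H = P.crkFun F

namespace DiscretePolymatroid

variable {n : ℕ} (P : DiscretePolymatroid n)

lemma sum_add_single (w : Fin n →₀ ℕ) (i : Fin n) :
    ∑ j, (w + Finsupp.single i 1 : Fin n →₀ ℕ) j = ∑ j, w j + 1 := by
  simp [Finset.sum_add_distrib, Finsupp.single_apply]

/-- If `A` is the set of directions in which `v ∈ P` cannot be increased, then no member
of `P` has larger modulus than `v` on `A`. -/
lemma sum_le_of_maximal_on {v u : Fin n →₀ ℕ} (hv : v ∈ P.carrier) (hu : u ∈ P.carrier)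
    {A : Finset (Fin n)} (hA : ∀ i, i ∈ A ↔ v + Finsupp.single i 1 ∉ P.carrier) :
    ∑ i ∈ A, u i ≤ ∑ i ∈ A, v i := by
  classical
  by_contra! hlt
  let C := P.carrier.filter fun w =>
    (∀ i, i ∉ A → w i ≤ v i) ∧ ∑ i ∈ A, v i < ∑ i ∈ A, w i
  have hC : C.Nonempty := by
    refine ⟨u.filter (· ∈ A), Finset.mem_filter.2 ⟨P.lower u hu _ fun i => ?_, ?_, ?_⟩⟩
    · by_cases h : i ∈ A <;> simp [h]
    · intro i hi
      simp [hi]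
    · refine hlt.trans_eq (Finset.sum_congr rfl fun i hi => ?_)
      simp [hi]
  obtain ⟨w, hwC, hmax⟩ := Finset.exists_max_image C (fun w => ∑ i, w i) hC
  obtain ⟨hwP, hwle, hwlt⟩ := Finset.mem_filter.1 hwC
  have hle : ∑ i, w i ≤ ∑ i, v i := by
    by_contra! h
    obtain ⟨i, hi, hi'⟩ := P.exchange v hv w hwP h
    by_cases hiA : i ∈ A
    · exact (hA i).1 hiA hi'
    · exact absurd (hwle i hiA) (not_le.2 hi)
  have hcompl : ∑ i ∈ Aᶜ, w i < ∑ i ∈ Aᶜ, v i := by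
    have h₁ := Finset.sum_add_sum_compl A w
    have h₂ := Finset.sum_add_sum_compl A v
    omega
  obtain ⟨j, hjA, hj⟩ := Finset.exists_lt_of_sum_lt hcompl
  rw [Finset.mem_compl] at hjA
  have hvj : v + Finsupp.single j 1 ∈ P.carrier := by
    by_contra h
    exact hjA ((hA j).2 h)
  obtain ⟨i, hi, hiP⟩ := P.exchange w hwP _ hvj (by rw [sum_add_single]; omega)
  have hmem : w + Finsupp.single i 1 ∈ C := by
    refine Finset.mem_filter.2 ⟨hiP, fun k hk => ?_, hwlt.trans_le ?_⟩
    · have hwk := hwle k hk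
      by_cases hki : i = k
      · subst hki
        by_cases hij : j = i
        · subst hij
          simpa using hj
        · simpa [Finsupp.single_apply, hij] using hi
      · simpa [Finsupp.single_apply, hki] using hwk
    · exact Finset.sum_le_sum fun k _ => by simp
  have := hmax _ hmem
  rw [sum_add_single] at this
  omega

/-- A vector dominates a basis as soon as it satisfies all the complementary rank
inequalities. -/
lemma exists_base_le {m : Fin n →₀ ℕ} (hm : ∀ F, P.crkFun F ≤ ∑ i ∈ F, m i) :
    ∃ u ∈ P.bases, u ≤ m := by
  classical
  have hne : (P.carrier.filter (· ≤ m)).Nonempty := by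
    obtain ⟨u, hu⟩ := P.nonempty
    exact ⟨0, Finset.mem_filter.2 ⟨P.lower u hu 0 (zero_le), zero_le⟩⟩
  obtain ⟨v, hv, hmax⟩ := Finset.exists_max_image _ (fun w => ∑ i, w i) hne
  obtain ⟨hvP, hvm⟩ := Finset.mem_filter.1 hv
  have hrank : ∑ i, v i ≤ P.rank := Finset.le_sup (f := fun u : Fin n →₀ ℕ => ∑ i, u i) hvP
  refine ⟨v, Finset.mem_filter.2 ⟨hvP, hrank.antisymm ?_⟩, hvm⟩
  let A := Finset.univ.filter fun i => v + Finsupp.single i 1 ∉ P.carrier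
  have hA : ∀ i, i ∈ A ↔ v + Finsupp.single i 1 ∉ P.carrier := by simp [A]
  have hrk : P.rkFun A ≤ ∑ i ∈ A, v i := Finset.sup_le fun u hu =>
    P.sum_le_of_maximal_on hvP (Finset.mem_filter.1 hu).1 hA
  have heq : ∑ i ∈ Aᶜ, m i ≤ ∑ i ∈ Aᶜ, v i := by
    refine Finset.sum_le_sum fun i hi => ?_
    by_contra! hlt
    have hiP : v + Finsupp.single i 1 ∈ P.carrier := by
      by_contra h
      exact Finset.mem_compl.1 hi ((hA i).2 h)
    have := hmax _ (Finset.mem_filter.2 ⟨hiP, fun k => by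
      by_cases hik : i = k
      · subst hik
        simpa using hlt
      · simpa [Finsupp.single_apply, hik] using hvm k⟩)
    rw [sum_add_single] at this
    omega
  have hcrk := hm Aᶜ
  rw [crkFun, compl_compl] at hcrk
  have := Finset.sum_add_sum_compl A v
  omega

lemma crkFun_le_sum_of_mem_bases {u : Fin n →₀ ℕ} (hu : u ∈ P.bases) (F : Finset (Fin n)) :
    P.crkFun F ≤ ∑ i ∈ F, u i := by
  have hsup : ∑ i ∈ Fᶜ, u i ≤ P.rkFun Fᶜ :=
    Finset.le_sup (f := fun u : Fin n →₀ ℕ => ∑ i ∈ Fᶜ, u i) hu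
  have hrank := (Finset.mem_filter.1 hu).2
  have := Finset.sum_add_sum_compl F u
  rw [crkFun]
  omega

/-- The complementary rank inequalities for all sets follow from those for the
`τ`-closed and `τ`-inseparable ones. -/
lemma crkFun_le_sum_of_closed_inseparable {m : Fin n →₀ ℕ}
    (hm : ∀ F, TauClosed P F → TauInseparable P F → P.crkFun F ≤ ∑ i ∈ F, m i)
    (F : Finset (Fin n)) : P.crkFun F ≤ ∑ i ∈ F, m i := by
  induction F using Finset.strongInduction with
  | H F ih =>
    by_cases hc : TauClosed P F
    · by_cases hs : TauInseparable P F
      · exact hm F hc hs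
      · obtain ⟨G, H, hG, hH, hd, rfl, hsum⟩ := not_not.1 hs
        rw [Finset.sum_union hd, ← hsum]
        refine add_le_add (ih G ?_) (ih H ?_)
        · refine Finset.subset_union_left.ssubset_of_ne fun h => hH.ne_empty ?_
          rw [Finset.left_eq_union] at h
          exact Finset.disjoint_self_iff_empty _ |>.1 (hd.mono_left h)
        · refine Finset.subset_union_right.ssubset_of_ne fun h => hG.ne_empty ?_
          rw [Finset.right_eq_union] at h
          exact Finset.disjoint_self_iff_empty _ |>.1 (hd.mono_right h)
    · unfold TauClosed at hc
      push Not at hc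
      obtain ⟨G, hGF, hle⟩ := hc
      exact hle.trans ((ih G hGF).trans (Finset.sum_le_sum_of_subset hGF.subset))

end DiscretePolymatroid

lemma monomial_mem_monomialPrimeIdeal_pow {n : ℕ} {F : Finset (Fin n)} {k : ℕ}
    {u : Fin n →₀ ℕ} (hk : k ≤ ∑ i ∈ F, u i) :
    monomial u (1 : K) ∈ monomialPrimeIdeal K F ^ k := by
  refine Ideal.pow_le_pow_right hk ?_
  have hu : monomial u (1 : K) = (∏ i ∈ F, X i ^ u i) * ∏ i ∈ Fᶜ, X i ^ u i := by
    rw [Finset.prod_mul_prod_compl, monomial_eq, C_1, one_mul,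
      Finsupp.prod_fintype _ _ fun i => pow_zero _]
  rw [hu, ← Finset.prod_pow_eq_pow_sum]
  exact Ideal.mul_mem_right _ _ (Ideal.prod_mem_prod fun i hi =>
    Ideal.pow_mem_pow (Ideal.subset_span (Set.mem_image_of_mem _ hi)) _)

lemma monomialPrimeIdeal_pow_le_span {n : ℕ} (F : Finset (Fin n)) (k : ℕ) :
    monomialPrimeIdeal K F ^ k ≤
      Ideal.span ((fun u => monomial u (1 : K)) '' {u | k ≤ ∑ i ∈ F, u i}) := by
  induction k with
  | zero =>
    rw [pow_zero, Ideal.one_eq_top, top_le_iff, Ideal.eq_top_iff_one]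
    exact Ideal.subset_span ⟨0, by simp, rfl⟩
  | succ k ih =>
    rw [pow_succ]
    refine (Ideal.mul_mono_left ih).trans ?_
    rw [monomialPrimeIdeal, Ideal.span_mul_span', Ideal.span_le]
    rintro _ ⟨_, ⟨u, hu, rfl⟩, _, ⟨i, hi, rfl⟩, rfl⟩
    refine Ideal.subset_span ⟨u + Finsupp.single i 1, ?_, ?_⟩
    · have hi : i ∈ F := hi
      have hu : k ≤ ∑ i ∈ F, u i := hu
      simp [Finset.sum_add_distrib, Finsupp.single_apply, hi, hu]
    · simp [X, monomial_mul]

lemma le_sum_of_mem_monomialPrimeIdeal_pow {n : ℕ} {F : Finset (Fin n)} {k : ℕ}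
    {f : MvPolynomial (Fin n) K} (hf : f ∈ monomialPrimeIdeal K F ^ k)
    {m : Fin n →₀ ℕ} (hm : m ∈ f.support) : k ≤ ∑ i ∈ F, m i := by
  obtain ⟨u, hu, hum⟩ :=
    mem_ideal_span_monomial_image.1 (monomialPrimeIdeal_pow_le_span K F k hf) m hm
  exact le_trans hu (Finset.sum_le_sum fun i _ => hum i)

/-- For a polymatroidal ideal `I` with complementary rank function
`τ`, one has `I = ⋂_F p_F^{τ(F)}`, the intersection over all `τ`-closed and
`τ`-inseparable subsets `F ⊆ [n]`. -/
theorem polymatroidal_tau_primary_decomposition {n : ℕ}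
    (P : DiscretePolymatroid n) (I : Ideal (MvPolynomial (Fin n) K))
    (hI : I = P.toIdeal K) :
    I = ⨅ F ∈ {F : Finset (Fin n) | TauClosed P F ∧ TauInseparable P F},
      (monomialPrimeIdeal K F) ^ (P.crkFun F) := by
  subst hI
  apply le_antisymm
  · refine le_iInf₂ fun F _ => Ideal.span_le.2 ?_
    rintro _ ⟨u, hu, rfl⟩
    exact monomial_mem_monomialPrimeIdeal_pow K (P.crkFun_le_sum_of_mem_bases hu F)
  · intro f hf
    refine mem_ideal_span_monomial_image.2 fun m hm =>
      P.exists_base_le (P.crkFun_le_sum_of_closed_inseparable fun F hc hs => ?_)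
    exact le_sum_of_mem_monomialPrimeIdeal_pow K
      ((Submodule.mem_iInf _).1 ((Submodule.mem_iInf _).1 hf F) ⟨hc, hs⟩) hm

end
end
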